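/- (Main theorem, bounded charity, Nash welfare.) For every ε with 0 < ε < 1 there exists a partial allocation X = (X_1,…,X_n) of M with charity P = M \ (X_1 ∪ … ∪ X_n) such that: (a) X is (1 − ε)-EFX; (b) |P| < n; (c) v_i(X_i) ≥ v_i(P) for every agent i; and (d) for every allocation X* = (X*_1,…,X*_n) of pairwise disjoint subsets of M, Π_i v_i(X_i) ≥ ( (1 − ε)/(4(n+1)) )^n · Π_i v_i(X*_i). -/

import Mathlib

/-- `X` is an allocation of (some of) the goods in `M`: the bundles are pairwise disjoint
subsets of `M`. -/
structure IsPartialAllocation {ι G : Type*} (M : Finset G) (X : ι → Finset G) : Prop where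
  subset : ∀ i, X i ⊆ M
  disjoint : ∀ i j, i ≠ j → Disjoint (X i) (X j)

/-- No agent values a bundle minus any one of its goods above their own bundle. -/
def IsEFX {ι G : Type*} [DecidableEq G] (v : ι → Finset G → ℝ) (X : ι → Finset G) : Prop :=
  ∀ i j, ∀ g ∈ X j, v i (X j \ {g}) ≤ v i (X i)

/-- A minimal envied subset of `S` is envied by someone but strongly envied by nobody. -/
lemma exists_minimal_envied_subset {ι G : Type*} [DecidableEq G] (v : ι → Finset G → ℝ)
    (X : ι → Finset G) (S : Finset G) (hS : ∃ i, v i (X i) < v i S) :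
    ∃ Z ⊆ S, (∃ i, v i (X i) < v i Z) ∧ ∀ i, ∀ g ∈ Z, v i (Z \ {g}) ≤ v i (X i) := by
  classical
  obtain ⟨Z, hZ, hmin⟩ := (S.powerset.filter fun Z => ∃ i, v i (X i) < v i Z).exists_min_image
    Finset.card ⟨S, by simpa using hS⟩
  simp only [Finset.mem_filter, Finset.mem_powerset] at hZ hmin
  refine ⟨Z, hZ.1, hZ.2, fun i g hg => ?_⟩
  by_contra! h
  have hle := hmin (Z \ {g}) ⟨Finset.sdiff_subset.trans hZ.1, i, h⟩
  have hlt := Finset.card_lt_card (Finset.sdiff_ssubset (Finset.singleton_subset_iff.2 hg)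
    (Finset.singleton_nonempty g))
  omega

/-- A self-map of a finite nonempty type is onto on some nonempty set of points. -/
lemma exists_nonempty_forall_exists_preimage {ι : Type*} [Finite ι] [Nonempty ι] (f : ι → ι) :
    ∃ C : Set ι, C.Nonempty ∧ ∀ i ∈ C, ∃ j ∈ C, f j = i := by
  refine ⟨Function.periodicPts f, ?_, fun i hi => (Function.bijOn_periodicPts f).surjOn hi⟩
  obtain ⟨i⟩ := ‹Nonempty ι›
  obtain ⟨a, b, hab, h⟩ := Finite.exists_ne_map_eq_of_infinite fun k : ℕ => f^[k] i
  wlog hlt : a < b generalizing a b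
  · exact this b a hab.symm h.symm (by omega)
  refine ⟨f^[a] i, b - a, by omega, ?_⟩
  change f^[b - a] (f^[a] i) = f^[a] i
  rw [← Function.iterate_add_apply, Nat.sub_add_cancel hlt.le]
  exact h.symm

/-- Among the EFX partial allocations weakly improving on a given one `A`, there is one which
leaves fewer goods unallocated than there are agents, and whose charity nobody envies. -/
theorem exists_isEFX_bounded_charity {ι G : Type*} [Fintype ι] [Nonempty ι] [DecidableEq G]
    (M : Finset G) (v : ι → Finset G → ℝ) (hmono : ∀ i A B, A ⊆ B → v i A ≤ v i B)
    (A : ι → Finset G) (hA : IsPartialAllocation M A) (hAE : IsEFX v A) :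
    ∃ X : ι → Finset G, IsPartialAllocation M X ∧ IsEFX v X ∧ (∀ i, v i (A i) ≤ v i (X i)) ∧
      (M \ Finset.univ.biUnion X).card < Fintype.card ι ∧
      ∀ i, v i (M \ Finset.univ.biUnion X) ≤ v i (X i) := by
  classical
  obtain ⟨X, hX, hmax⟩ := ((Fintype.piFinset fun _ : ι => M.powerset).filter fun X =>
      IsPartialAllocation M X ∧ IsEFX v X ∧ ∀ i, v i (A i) ≤ v i (X i)).exists_max_image
    (fun X => toLex (∑ i, v i (X i), ∑ i, (X i).card))
    ⟨A, by simpa using ⟨hA.subset, hA, hAE⟩⟩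
  simp only [Finset.mem_filter, Fintype.mem_piFinset, Finset.mem_powerset] at hX hmax
  obtain ⟨-, hXA, hXE, hXdom⟩ := hX
  have hstuck : ∀ Y, IsPartialAllocation M Y → IsEFX v Y → (∀ i, v i (X i) ≤ v i (Y i)) →
      ∑ i, (Y i).card ≤ ∑ i, (X i).card ∧ ∀ i, v i (Y i) = v i (X i) := by
    intro Y hY hYE hYdom
    have hlex := hmax Y ⟨hY.subset, hY, hYE, fun i => (hXdom i).trans (hYdom i)⟩
    have hsum := Finset.sum_le_sum fun i (_ : i ∈ Finset.univ) => hYdom i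
    rw [Prod.Lex.toLex_le_toLex] at hlex
    rcases hlex with h | ⟨h, hcard⟩
    · exact absurd h (not_lt.2 hsum)
    · exact ⟨hcard, fun i => ((Finset.sum_eq_sum_iff_of_le fun i _ => hYdom i).1 h.symm i
        (Finset.mem_univ i)).symm⟩
  set P := M \ Finset.univ.biUnion X
  have hPX : ∀ i, Disjoint P (X i) := fun i => Finset.disjoint_of_subset_right
    (Finset.subset_biUnion_of_mem X (Finset.mem_univ i)) Finset.sdiff_disjoint
  -- Replacing the bundles of the agents in `C` by envied, not strongly envied, disjoint bundles
  -- contradicts maximality.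
  have hreplace : ∀ (C : Set ι) (Y : ι → Finset G), C.Nonempty → (∀ i ∈ C, Y i ⊆ M) →
      (∀ i ∈ C, ∀ j ∈ C, i ≠ j → Disjoint (Y i) (Y j)) →
      (∀ i ∈ C, ∀ j ∉ C, Disjoint (Y i) (X j)) →
      (∀ i ∈ C, v i (X i) < v i (Y i)) →
      (∀ j ∈ C, ∀ i, ∀ g ∈ Y j, v i (Y j \ {g}) ≤ v i (X i)) → False := by
    intro C Y ⟨c, hc⟩ hYM hYY hYX hlt hYE
    have hdom : ∀ i, v i (X i) ≤ v i (C.piecewise Y X i) := by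
      intro i
      by_cases hi : i ∈ C
      · simpa [hi] using (hlt i hi).le
      · simp [hi]
    have h := (hstuck (C.piecewise Y X) ⟨fun i => ?_, fun i j hij => ?_⟩
      (fun i j g hg => ?_) hdom).2 c
    · have := hlt c hc
      simp only [hc, Set.piecewise_eq_of_mem] at h
      linarith
    · by_cases hi : i ∈ C
      · simpa [hi] using hYM i hi
      · simpa [hi] using hXA.subset i
    · by_cases hi : i ∈ C <;> by_cases hj : j ∈ C
      · simpa [hi, hj] using hYY i hi j hj hij
      · simpa [hi, hj] using hYX i hi j hj
      · simpa [hi, hj] using (hYX j hj i hi).symm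
      · simpa [hi, hj] using hXA.disjoint i j hij
    · refine le_trans ?_ (hdom i)
      by_cases hj : j ∈ C
      · simp only [hj, Set.piecewise_eq_of_mem] at hg ⊢
        exact hYE j hj i g hg
      · simp only [hj, not_false_eq_true, Set.piecewise_eq_of_notMem] at hg ⊢
        exact hXE i j g hg
  refine ⟨X, hXA, hXE, hXdom, ?_, ?_⟩
  · by_contra! hcard
    obtain ⟨e⟩ : Nonempty (ι ↪ P) :=
      Function.Embedding.nonempty_of_card_le (by simpa using hcard)
    have heP : ∀ j, (e j : G) ∈ P := fun j => (e j).2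
    have heX : ∀ i j, (e j : G) ∉ X i := fun i j =>
      Finset.disjoint_left.1 (hPX i) (heP j)
    have hinj : ∀ i j, (e i : G) = e j → i = j := fun i j h => e.injective (Subtype.ext h)
    have hins : ∀ i j, i ≠ j → Disjoint (insert (e i : G) (X i)) (insert (e j : G) (X j)) := by
      intro i j hij
      simp only [Finset.disjoint_insert_left, Finset.disjoint_insert_right, Finset.mem_insert,
        not_or]
      exact ⟨⟨fun h => hij (hinj j i h).symm, heX i j⟩, heX j i, hXA.disjoint i j hij⟩
    have hinsX : ∀ i j, i ≠ j → Disjoint (insert (e i : G) (X i)) (X j) := fun i j hij =>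
      Finset.disjoint_of_subset_right (Finset.subset_insert _ _) (hins i j hij)
    have hinsM : ∀ j, insert (e j : G) (X j) ⊆ M := fun j =>
      Finset.insert_subset (Finset.sdiff_subset (heP j)) (hXA.subset j)
    have henv : ∀ j, ∃ i, v i (X i) < v i (insert (e j : G) (X j)) := by
      intro j
      by_contra! hno
      have hdom : ∀ i, v i (X i) ≤ v i (Function.update X j (insert (e j : G) (X j)) i) := by
        intro i
        rcases eq_or_ne i j with rfl | hi
        · simpa using hmono i _ _ (Finset.subset_insert _ _)
        · simp [hi]
      have h := (hstuck (Function.update X j (insert (e j : G) (X j)))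
        ⟨fun i => ?_, fun i k hik => ?_⟩ (fun i k g hg => ?_) hdom).1
      · refine absurd h (not_le.2 (Finset.sum_lt_sum (fun i _ => ?_) ⟨j, Finset.mem_univ j, ?_⟩))
        · rcases eq_or_ne i j with rfl | hi
          · simpa using Finset.card_le_card (Finset.subset_insert (e i : G) (X i))
          · simp [hi]
        · simp [heX j j]
      · rcases eq_or_ne i j with rfl | hi
        · simpa using hinsM i
        · simpa [hi] using hXA.subset i
      · rcases eq_or_ne i j with rfl | hi
        · simpa [hik.symm] using hinsX i k hik
        · rcases eq_or_ne k j with rfl | hk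
          · simpa [hi] using (hinsX k i hik.symm).symm
          · simpa [hi, hk] using hXA.disjoint i k hik
      · refine le_trans ?_ (hdom i)
        rcases eq_or_ne k j with rfl | hk
        · rw [Function.update_self]
          exact (hmono i _ _ Finset.sdiff_subset).trans (hno i)
        · rw [Function.update_of_ne hk] at hg ⊢
          exact hXE i k g hg
    choose Z hZsub hZenv hZE using fun j => exists_minimal_envied_subset v X _ (henv j)
    choose f hf using hZenv
    obtain ⟨C, hC, hsurj⟩ := exists_nonempty_forall_exists_preimage f
    choose! σ hσC hσ using hsurj
    refine hreplace C (fun i => Z (σ i)) hC (fun i _ => (hZsub _).trans (hinsM _))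
      (fun i hi j hj hij => ?_) (fun i hi j hj => ?_) (fun i hi => ?_)
      (fun j _ i g hg => hZE _ i g hg)
    · refine Finset.disjoint_of_subset_left (hZsub _)
        (Finset.disjoint_of_subset_right (hZsub _) (hins _ _ fun h => hij ?_))
      rw [← hσ i hi, h, hσ j hj]
    · exact Finset.disjoint_of_subset_left (hZsub _)
        (hinsX _ _ fun h => hj (h ▸ hσC i hi))
    · simpa [hσ i hi] using hf (σ i)
  · by_contra! henv
    obtain ⟨Z, hZP, ⟨i, hi⟩, hZE⟩ := exists_minimal_envied_subset v X P henv
    refine hreplace {i} (fun _ => Z) (Set.singleton_nonempty i)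
      (fun _ _ => hZP.trans Finset.sdiff_subset) (fun a ha b hb hab => ?_)
      (fun _ _ j _ => Finset.disjoint_of_subset_left hZP (hPX j)) (fun j hj => ?_)
      (fun _ _ => hZE)
    · exact absurd (ha.trans hb.symm) hab
    · obtain rfl : j = i := hj
      exact hi

/-- A subadditive function is subadditive over finite unions. -/
lemma apply_biUnion_le_sum {ι G : Type*} [DecidableEq G] (w : Finset G → ℝ) (h0 : w ∅ = 0)
    (hsub : ∀ A B, w (A ∪ B) ≤ w A + w B) (s : Finset ι) (F : ι → Finset G) :
    w (s.biUnion F) ≤ ∑ i ∈ s, w (F i) := by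
  classical
  induction s using Finset.induction_on with
  | empty => simp [h0]
  | insert a s ha ih =>
    rw [Finset.biUnion_insert, Finset.sum_insert ha]
    exact (hsub _ _).trans (by gcongr)

/-- Each agent of an EFX allocation who does not envy the charity has at least a `1 / (|ι| + 1)`
share of what remains of `M` after removing some `|ι|` goods. -/
lemma IsEFX.exists_apply_sdiff_le {ι G : Type*} [Fintype ι] [DecidableEq G]
    {M : Finset G} {v : ι → Finset G → ℝ} (hv0 : ∀ i A, 0 ≤ v i A) (hnorm : ∀ i, v i ∅ = 0)
    (hmono : ∀ i A B, A ⊆ B → v i A ≤ v i B) (hsub : ∀ i A B, v i (A ∪ B) ≤ v i A + v i B)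
    {X : ι → Finset G} (hX : IsPartialAllocation M X) (hE : IsEFX v X)
    (hP : ∀ i, v i (M \ Finset.univ.biUnion X) ≤ v i (X i)) :
    ∃ S ⊆ M, S.card ≤ Fintype.card ι ∧
      ∀ i, v i (M \ S) ≤ ((Fintype.card ι : ℝ) + 1) * v i (X i) := by
  have hT : ∀ j, ∃ T ⊆ X j, T.card ≤ 1 ∧ ∀ i, v i (X j \ T) ≤ v i (X i) := by
    intro j
    rcases (X j).eq_empty_or_nonempty with h | ⟨g, hg⟩
    · exact ⟨∅, by simp, by simp, fun i => by simp [h, hnorm, hv0]⟩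
    · exact ⟨{g}, by simpa using hg, by simp, fun i => hE i j g hg⟩
  choose T hTX hTcard hTv using hT
  refine ⟨Finset.univ.biUnion T, Finset.biUnion_subset.2 fun j _ => (hTX j).trans (hX.subset j),
    ?_, fun i => ?_⟩
  · simpa using Finset.card_biUnion_le_card_mul Finset.univ T 1 fun j _ => hTcard j
  · have hcover : M \ Finset.univ.biUnion T ⊆
        (Finset.univ.biUnion fun j => X j \ T j) ∪ (M \ Finset.univ.biUnion X) := by
      intro g hg
      simp only [Finset.mem_sdiff, Finset.mem_biUnion, Finset.mem_univ, true_and, not_exists,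
        Finset.mem_union] at hg ⊢
      by_cases h : ∃ j, g ∈ X j
      · obtain ⟨j, hj⟩ := h
        exact Or.inl ⟨j, hj, hg.2 j⟩
      · exact Or.inr ⟨hg.1, fun j hj => h ⟨j, hj⟩⟩
    calc v i (M \ Finset.univ.biUnion T)
        ≤ v i (Finset.univ.biUnion fun j => X j \ T j) + v i (M \ Finset.univ.biUnion X) :=
          (hmono i _ _ hcover).trans (hsub i _ _)
      _ ≤ ∑ _j : ι, v i (X i) + v i (X i) := by
          gcongr
          · exact (apply_biUnion_le_sum (v i) (hnorm i) (hsub i) _ _).trans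
              (Finset.sum_le_sum fun j _ => hTv j i)
          · exact hP i
      _ = ((Fintype.card ι : ℝ) + 1) * v i (X i) := by simp; ring

/-- A bundle is worth at most the rest of the goods after removing `S`, plus `|S|` copies of
its best good. -/
lemma apply_le_add_card_mul {G : Type*} [DecidableEq G] {w : Finset G → ℝ} (h0 : w ∅ = 0)
    (hmono : ∀ A B, A ⊆ B → w A ≤ w B) (hsub : ∀ A B, w (A ∪ B) ≤ w A + w B)
    {M B : Finset G} (S : Finset G) (hB : B ⊆ M) {c : ℝ} (hc0 : 0 ≤ c)
    (hc : ∀ g ∈ B, w {g} ≤ c) :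
    w B ≤ w (M \ S) + S.card * c := by
  have hunion : w (B ∩ S) ≤ S.card * c := by
    calc w (B ∩ S) = w ((B ∩ S).biUnion singleton) := by rw [Finset.biUnion_singleton_eq_self]
      _ ≤ ∑ g ∈ B ∩ S, w {g} := apply_biUnion_le_sum w h0 hsub _ _
      _ ≤ ∑ _g ∈ B ∩ S, c := Finset.sum_le_sum fun g hg => hc g (Finset.mem_inter.1 hg).1
      _ ≤ S.card * c := by
        rw [Finset.sum_const, nsmul_eq_mul]
        gcongr
        exact Finset.inter_subset_right
  calc w B = w (B \ S ∪ B ∩ S) := by rw [Finset.sdiff_union_inter]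
    _ ≤ w (B \ S) + w (B ∩ S) := hsub _ _
    _ ≤ w (M \ S) + S.card * c := by
      gcongr
      exact hmono _ _ (Finset.sdiff_subset_sdiff hB le_rfl)

/-- Main theorem, bounded charity, Nash welfare: For every
`ε ∈ (0, 1)` there is a partial `(1 - ε)`-EFX allocation `X` with charity
`P = M \ (X₁ ∪ … ∪ Xₙ)` such that `|P| < n`, `v i (X i) ≥ v i P` for every
agent, and the Nash welfare of `X` is at least `((1 - ε)/(4(n+1)))^n` times
that of any allocation. -/
theorem main_charity_nash
    {G : Type*} [DecidableEq G]
    (n : ℕ) (hn : 0 < n) (M : Finset G) (hm : n ≤ M.card)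
    (v : Fin n → Finset G → ℝ)
    (hv0 : ∀ i A, 0 ≤ v i A)
    (hnorm : ∀ i, v i ∅ = 0)
    (hmono : ∀ i A B, A ⊆ B → v i A ≤ v i B)
    (hsub : ∀ i A B, v i (A ∪ B) ≤ v i A + v i B)
    (ε : ℝ) (hε0 : 0 < ε) (hε1 : ε < 1) :
    ∃ X : Fin n → Finset G,
      (∀ i, X i ⊆ M) ∧
      (∀ i j, i ≠ j → Disjoint (X i) (X j)) ∧
      (∀ i j, ∀ g ∈ X j, (1 - ε) * v i (X j \ {g}) ≤ v i (X i)) ∧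
      ((M \ Finset.univ.biUnion X).card < n) ∧
      (∀ i, v i (M \ Finset.univ.biUnion X) ≤ v i (X i)) ∧
      (∀ Xs : Fin n → Finset G, (∀ i, Xs i ⊆ M) →
        (∀ i j, i ≠ j → Disjoint (Xs i) (Xs j)) →
        ((1 - ε) / (4 * ((n : ℝ) + 1))) ^ n * ∏ i, v i (Xs i)
          ≤ ∏ i, v i (X i)) := by
  have : NeZero n := ⟨hn.ne'⟩
  have hn1 : (0 : ℝ) < n + 1 := by positivity
  have hmin : ∀ i, ∃ S ⊆ M, S.card ≤ n ∧
      ∀ T ⊆ M, T.card ≤ n → v i (M \ S) ≤ v i (M \ T) := by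
    intro i
    obtain ⟨S, hS, hSmin⟩ := (M.powerset.filter fun S => S.card ≤ n).exists_min_image
      (fun S => v i (M \ S)) ⟨∅, by simp⟩
    simp only [Finset.mem_filter, Finset.mem_powerset] at hS hSmin
    exact ⟨S, hS.1, hS.2, fun T hT hTn => hSmin T ⟨hT, hTn⟩⟩
  choose S hSM hSn hSmin using hmin
  have : Nonempty (Fin n ↪ M) :=
    Function.Embedding.nonempty_of_card_le (by simpa using hm)
  obtain ⟨a, ha⟩ := Finite.exists_max fun a : Fin n ↪ M =>
    ∏ i, max (v i {(a i : G)}) (v i (M \ S i) / (n + 1))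
  obtain ⟨X, hX, hXE, hXa, hXcard, hXP⟩ := exists_isEFX_bounded_charity M v hmono
    (fun i => {(a i : G)})
    ⟨fun i => by simp, fun i j hij => by
      simpa [Finset.disjoint_singleton, Subtype.ext_iff] using a.injective.ne hij⟩
    (fun i j g hg => by
      obtain rfl := Finset.mem_singleton.1 hg
      simp [hnorm, hv0])
  refine ⟨X, hX.subset, hX.disjoint, fun i j g hg => ?_, by simpa using hXcard, hXP,
    fun Xs hXsM hXsd => ?_⟩
  · exact (mul_le_of_le_one_left (hv0 _ _) (by linarith)).trans (hXE i j g hg)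
  have hc0 : 0 ≤ (1 - ε) / (4 * ((n : ℝ) + 1)) := div_nonneg (by linarith) (by positivity)
  by_cases hempty : ∃ i, Xs i = ∅
  · obtain ⟨i, hi⟩ := hempty
    rw [Finset.prod_eq_zero (Finset.mem_univ i) (by rw [hi, hnorm]), mul_zero]
    exact Finset.prod_nonneg fun i _ => hv0 _ _
  push Not at hempty
  have hbest : ∀ i, ∃ h ∈ Xs i, ∀ g ∈ Xs i, v i {g} ≤ v i {h} := fun i =>
    (Xs i).exists_max_image (fun g => v i {g}) (hempty i)
  choose h hhXs hhmax using hbest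
  let b : Fin n ↪ M := ⟨fun i => ⟨h i, hXsM i (hhXs i)⟩, fun i j hij => by
    by_contra hne
    have hval : h i = h j := congrArg Subtype.val hij
    exact Finset.disjoint_left.1 (hXsd i j hne) (hhXs i) (hval ▸ hhXs j)⟩
  obtain ⟨T, hTM, hTn, hT⟩ := hXE.exists_apply_sdiff_le hv0 hnorm hmono hsub hX hXP
  rw [Fintype.card_fin] at hTn hT
  calc ((1 - ε) / (4 * ((n : ℝ) + 1))) ^ n * ∏ i, v i (Xs i)
      = ∏ i, (1 - ε) / (4 * ((n : ℝ) + 1)) * v i (Xs i) := by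
        rw [Finset.prod_mul_distrib, Finset.prod_const, Finset.card_univ, Fintype.card_fin]
    _ ≤ ∏ i, max (v i {(b i : G)}) (v i (M \ S i) / (n + 1)) := by
        refine Finset.prod_le_prod (fun i _ => mul_nonneg hc0 (hv0 _ _)) fun i _ => ?_
        set m := max (v i {(b i : G)}) (v i (M \ S i) / (n + 1))
        have hm1 : v i {h i} ≤ m := le_max_left _ _
        have hm2 : v i (M \ S i) ≤ m * (n + 1) := (div_le_iff₀ hn1).1 (le_max_right _ _)
        have hm0 : 0 ≤ m := (hv0 _ _).trans hm1
        have hbound : v i (Xs i) ≤ m * (n + 1) + n * m :=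
          calc v i (Xs i) ≤ v i (M \ S i) + (S i).card * m :=
                apply_le_add_card_mul (hnorm i) (hmono i) (hsub i) (S i) (hXsM i) hm0
                  fun g hg => (hhmax i g hg).trans hm1
            _ ≤ m * (n + 1) + n * m := by
                gcongr
                exact hSn i
        rw [div_mul_eq_mul_div, div_le_iff₀ (by positivity)]
        have hshrink : (1 - ε) * v i (Xs i) ≤ v i (Xs i) :=
          mul_le_of_le_one_left (hv0 _ _) (by linarith)
        nlinarith [mul_nonneg hm0 (Nat.cast_nonneg (α := ℝ) n)]
    _ ≤ ∏ i, max (v i {(a i : G)}) (v i (M \ S i) / (n + 1)) := ha b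
    _ ≤ ∏ i, v i (X i) := by
        refine Finset.prod_le_prod (fun i _ => le_max_of_le_left (hv0 _ _)) fun i _ =>
          max_le (hXa i) ?_
        rw [div_le_iff₀' hn1]
        exact (hSmin i T hTM hTn).trans (hT i)
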